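/- arXiv:2110.10712 — 7 statements merged into one kernel-verified Lean document; each statement's English description precedes it below -/
import Mathlib

section
/- Let n ≥ 1 and let x = (x_0, …, x_n) ∈ ℝ^{n+1}. For each k with 1 ≤ k ≤ n, the real number g_k(x) = min_{0 ≤ p ≤ k-1} max_{k ≤ q ≤ n} (x_p − x_q)/(q − p) is a tropical zero of the tropical polynomial f(Y) = min_{0 ≤ m ≤ n} (x_m + mY); that is, there exist two distinct indices a ≠ b in {0, …, n} such that x_a + a·g_k(x) = x_b + b·g_k(x) = min_{0 ≤ m ≤ n} (x_m + m·g_k(x)). -/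
/-- The parametric tropical zero
`g_k(x) = min_{0 ≤ p ≤ k-1} max_{k ≤ q ≤ n} (x_p − x_q)/(q − p)`. -/
noncomputable def tropG (n k : ℕ) (x : ℕ → ℝ) (h1 : 1 ≤ k) (h2 : k ≤ n) : ℝ :=
  (Finset.range k).inf' (Finset.nonempty_range_iff.mpr (by omega))
    (fun p => (Finset.Icc k n).sup' (Finset.nonempty_Icc.mpr h2)
      (fun q => (x p - x q) / ((q : ℝ) - (p : ℝ))))

/-- for every `x ∈ ℝ^{n+1}` and every `1 ≤ k ≤ n`, the value
`g_k(x)` is a tropical zero of `f(Y) = min_{0 ≤ m ≤ n} (x_m + m·Y)`: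
the minimum is attained at two distinct indices. -/
theorem tropG_isTropicalZero (n : ℕ) (hn : 1 ≤ n) (x : ℕ → ℝ) (k : ℕ)
    (h1 : 1 ≤ k) (h2 : k ≤ n) :
    ∃ a b : ℕ, a ≤ n ∧ b ≤ n ∧ a ≠ b ∧
      x a + a * tropG n k x h1 h2 = x b + b * tropG n k x h1 h2 ∧
      ∀ m : ℕ, m ≤ n →
        x a + a * tropG n k x h1 h2 ≤ x m + m * tropG n k x h1 h2 := by
  have hne : (Finset.range k).Nonempty := Finset.nonempty_range_iff.mpr (by omega)
  have hne' : (Finset.Icc k n).Nonempty := Finset.nonempty_Icc.mpr h2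
  have hsub : ∀ {p q : ℕ}, p < k → k ≤ q → (0 : ℝ) < (q : ℝ) - p := fun hp hq =>
    sub_pos.mpr (Nat.cast_lt.mpr (hp.trans_le hq))
  obtain ⟨p, hp, hyp⟩ := Finset.exists_mem_eq_inf' hne
    (fun p => (Finset.Icc k n).sup' hne' fun q => (x p - x q) / ((q : ℝ) - (p : ℝ)))
  obtain ⟨q, hq, hyq⟩ := Finset.exists_mem_eq_sup' hne'
    (fun q => (x p - x q) / ((q : ℝ) - (p : ℝ)))
  have hmax : ∀ j ∈ Finset.Icc k n, (x p - x j) / ((j : ℝ) - (p : ℝ)) ≤ tropG n k x h1 h2 :=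
    fun j hj => (Finset.le_sup' (fun q => (x p - x q) / ((q : ℝ) - (p : ℝ))) hj).trans hyp.ge
  have heq : tropG n k x h1 h2 = (x p - x q) / ((q : ℝ) - (p : ℝ)) := hyp.trans hyq
  have hmin : ∀ i ∈ Finset.range k, ∃ j ∈ Finset.Icc k n,
      tropG n k x h1 h2 ≤ (x i - x j) / ((j : ℝ) - (i : ℝ)) := fun i hi =>
    (Finset.le_sup'_iff hne').mp (Finset.inf'_le
      (fun p => (Finset.Icc k n).sup' hne' fun q => (x p - x q) / ((q : ℝ) - (p : ℝ))) hi)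
  generalize tropG n k x h1 h2 = y at *
  rw [Finset.mem_range] at hp
  rw [Finset.mem_Icc] at hq
  have hright : ∀ j, k ≤ j → j ≤ n → x p + p * y ≤ x j + j * y := fun j hkj hjn => by
    have h := (div_le_iff₀ (hsub hp hkj)).mp (hmax j (Finset.mem_Icc.mpr ⟨hkj, hjn⟩))
    linarith
  refine ⟨p, q, by omega, hq.2, by omega, ?_, fun m hm => ?_⟩
  · have h := (eq_div_iff (hsub hp hq.1).ne').mp heq
    linarith
  · rcases lt_or_ge m k with hmk | hkm
    · obtain ⟨j, hj, hyj⟩ := hmin m (Finset.mem_range.mpr hmk)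
      rw [Finset.mem_Icc] at hj
      have h := (le_div_iff₀ (hsub hmk hj.1)).mp hyj
      linarith [hright j hj.1 hj.2]
    · exact hright m hkm hm
end

section
/- Let n ≥ 1 and let x = (x_0, …, x_n) ∈ ℝ^{n+1}. If y ∈ ℝ is a tropical zero of the tropical polynomial f(Y) = min_{0 ≤ m ≤ n} (x_m + mY) at x (i.e., the minimum min_{0 ≤ m ≤ n} (x_m + m·y) is attained at two distinct indices), then there exists k with 1 ≤ k ≤ n such that y = g_k(x) = min_{0 ≤ p ≤ k-1} max_{k ≤ q ≤ n} (x_p − x_q)/(q − p). Consequently, for every x the set of tropical zeroes of f at x is exactly {g_1(x), …, g_n(x)}. -/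
/-- `y` is a tropical zero of `f(Y) = min_{0 ≤ m ≤ n} (x_m + m·Y)` at `x`:
the minimum is attained at two distinct indices. -/
def IsTropicalZero (n : ℕ) (x : ℕ → ℝ) (y : ℝ) : Prop :=
  ∃ a b : ℕ, a ≤ n ∧ b ≤ n ∧ a ≠ b ∧
    x a + a * y = x b + b * y ∧
    ∀ m : ℕ, m ≤ n → x a + a * y ≤ x m + m * y

theorem eq_tropG_iff (n k : ℕ) (x : ℕ → ℝ) (h1 : 1 ≤ k) (h2 : k ≤ n) (y : ℝ) :
    y = tropG n k x h1 h2 ↔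
      (∀ p < k, ∃ q, k ≤ q ∧ q ≤ n ∧ x q + q * y ≤ x p + p * y) ∧
      ∃ p < k, ∀ q, k ≤ q → q ≤ n → x p + p * y ≤ x q + q * y := by
  have hpos {p q : ℕ} (hp : p < k) (hq : k ≤ q) : (0 : ℝ) < (q : ℝ) - p :=
    sub_pos.mpr (by exact_mod_cast hp.trans_le hq)
  have hle {p q : ℕ} (hp : p < k) (hq : k ≤ q) :
      y ≤ (x p - x q) / ((q : ℝ) - p) ↔ x q + q * y ≤ x p + p * y := by
    rw [le_div_iff₀ (hpos hp hq)]
    constructor <;> intro h <;> linarith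
  have hge {p q : ℕ} (hp : p < k) (hq : k ≤ q) :
      (x p - x q) / ((q : ℝ) - p) ≤ y ↔ x p + p * y ≤ x q + q * y := by
    rw [div_le_iff₀ (hpos hp hq)]
    constructor <;> intro h <;> linarith
  rw [le_antisymm_iff, tropG, Finset.le_inf'_iff, Finset.inf'_le_iff]
  simp only [Finset.le_sup'_iff, Finset.sup'_le_iff, Finset.mem_range, Finset.mem_Icc]
  constructor
  · rintro ⟨h, p, hp, hq⟩
    refine ⟨fun p hp => ?_, p, hp, fun q hkq hqn => (hge hp hkq).1 (hq q ⟨hkq, hqn⟩)⟩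
    obtain ⟨q, ⟨hkq, hqn⟩, hy⟩ := h p hp
    exact ⟨q, hkq, hqn, (hle hp hkq).1 hy⟩
  · rintro ⟨h, p, hp, hq⟩
    refine ⟨fun p hp => ?_, p, hp, fun q hqm => (hge hp hqm.1).2 (hq q hqm.1 hqm.2)⟩
    obtain ⟨q, hkq, hqn, hy⟩ := h p hp
    exact ⟨q, ⟨hkq, hqn⟩, (hle hp hkq).2 hy⟩

theorem IsTropicalZero.exists_lt {n : ℕ} {x : ℕ → ℝ} {y : ℝ} (h : IsTropicalZero n x y) :
    ∃ a b : ℕ, a < b ∧ b ≤ n ∧ (∀ m ≤ n, x a + a * y ≤ x m + m * y) ∧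
      ∀ m ≤ n, x b + b * y ≤ x m + m * y := by
  obtain ⟨a, b, ha, hb, hab, heq, hmin⟩ := h
  rcases hab.lt_or_gt with hlt | hlt
  · exact ⟨a, b, hlt, hb, hmin, fun m hm => heq ▸ hmin m hm⟩
  · exact ⟨b, a, hlt, ha, fun m hm => heq ▸ hmin m hm, hmin⟩

theorem IsTropicalZero.exists_eq_tropG {n : ℕ} {x : ℕ → ℝ} {y : ℝ} (h : IsTropicalZero n x y) :
    ∃ k : ℕ, ∃ h1 : 1 ≤ k, ∃ h2 : k ≤ n, y = tropG n k x h1 h2 := by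
  obtain ⟨a, b, hab, hb, ha_min, hb_min⟩ := h.exists_lt
  refine ⟨b, by omega, hb, (eq_tropG_iff ..).2 ⟨fun p hp => ?_, a, hab, fun q _ hq => ha_min q hq⟩⟩
  exact ⟨b, le_rfl, hb, hb_min p (by omega)⟩

theorem isTropicalZero_tropG (n k : ℕ) (x : ℕ → ℝ) (h1 : 1 ≤ k) (h2 : k ≤ n) :
    IsTropicalZero n x (tropG n k x h1 h2) := by
  obtain ⟨h, p, hp, hmin⟩ := (eq_tropG_iff n k x h1 h2 _).1 rfl
  obtain ⟨q, hkq, hqn, hqp⟩ := h p hp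
  refine ⟨p, q, by omega, hqn, by omega, le_antisymm (hmin q hkq hqn) hqp, fun m hm => ?_⟩
  rcases lt_or_ge m k with hmk | hmk
  · obtain ⟨r, hkr, hrn, hrm⟩ := h m hmk
    exact (hmin r hkr hrn).trans hrm
  · exact hmin m hmk hm

/-- every tropical zero `y` of `f` at `x` equals `g_k(x)` for some
`1 ≤ k ≤ n`; consequently the set of tropical zeroes of `f` at `x` is exactly
`{g_1(x), …, g_n(x)}`. -/
theorem tropicalZero_eq_tropG (n : ℕ) (hn : 1 ≤ n) (x : ℕ → ℝ) :
    (∀ y : ℝ, IsTropicalZero n x y →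
      ∃ k : ℕ, ∃ h1 : 1 ≤ k, ∃ h2 : k ≤ n, y = tropG n k x h1 h2) ∧
    {y : ℝ | IsTropicalZero n x y} =
      {y : ℝ | ∃ k : ℕ, ∃ h1 : 1 ≤ k, ∃ h2 : k ≤ n, y = tropG n k x h1 h2} := by
  refine ⟨fun y hy => hy.exists_eq_tropG, Set.ext fun y => ⟨fun hy => hy.exists_eq_tropG, ?_⟩⟩
  rintro ⟨k, h1, h2, rfl⟩
  exact isTropicalZero_tropG n k x h1 h2
end

section
/- Let n ≥ 1, let x = (x_0, …, x_n) ∈ ℝ^{n+1}, and let 1 ≤ k ≤ n. Then the minimax equality min_{0 ≤ p ≤ k-1} max_{k ≤ q ≤ n} (x_p − x_q)/(q − p) = max_{k ≤ q ≤ n} min_{0 ≤ p ≤ k-1} (x_p − x_q)/(q − p) holds; that is, g_k(x) admits the dual representation g_k(x) = max_{k ≤ q ≤ n} r_q(x) where r_q(x) = min_{0 ≤ p ≤ k-1} (x_p − x_q)/(q − p). -/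
/-- the minimax equality
`min_{0 ≤ p ≤ k-1} max_{k ≤ q ≤ n} (x_p − x_q)/(q − p)
  = max_{k ≤ q ≤ n} min_{0 ≤ p ≤ k-1} (x_p − x_q)/(q − p)`,
i.e. `g_k(x) = max_{k ≤ q ≤ n} r_q(x)` with
`r_q(x) = min_{0 ≤ p ≤ k-1} (x_p − x_q)/(q − p)`. -/
theorem tropG_minimax (n : ℕ) (hn : 1 ≤ n) (x : ℕ → ℝ) (k : ℕ)
    (h1 : 1 ≤ k) (h2 : k ≤ n) :
    tropG n k x h1 h2 =
      (Finset.Icc k n).sup' (Finset.nonempty_Icc.mpr h2)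
        (fun q => (Finset.range k).inf' (Finset.nonempty_range_iff.mpr (by omega))
          (fun p => (x p - x q) / ((q : ℝ) - (p : ℝ)))) := by
  apply le_antisymm
  · set g := tropG n k x h1 h2 with hg
    obtain ⟨p, hp, hpmin⟩ := Finset.exists_min_image (Finset.range k)
      (fun i => x i + i * g) (Finset.nonempty_range_iff.mpr (by omega))
    have hsup : g ≤ (Finset.Icc k n).sup' (Finset.nonempty_Icc.mpr h2)
        (fun q => (x p - x q) / ((q : ℝ) - (p : ℝ))) :=
      Finset.inf'_le _ hp
    obtain ⟨q, hq, hpq⟩ := (Finset.le_sup'_iff _).mp hsup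
    have hlt : ∀ i ∈ Finset.range k, (0 : ℝ) < (q : ℝ) - (i : ℝ) := fun i hi =>
      sub_pos.mpr (Nat.cast_lt.mpr ((Finset.mem_range.mp hi).trans_le (Finset.mem_Icc.mp hq).1))
    rw [le_div_iff₀ (hlt p hp)] at hpq
    refine (Finset.le_sup'_iff _).mpr ⟨q, hq, (Finset.le_inf'_iff _ _).mpr fun i hi => ?_⟩
    rw [le_div_iff₀ (hlt i hi)]
    linarith [hpmin i hi]
  · refine Finset.sup'_le _ _ fun q hq => Finset.le_inf' _ _ fun p hp => ?_
    exact (Finset.inf'_le _ hp).trans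
      (Finset.le_sup' (fun q : ℕ => (x p - x q) / ((q : ℝ) - (p : ℝ))) hq)
end

section
/- Let n ≥ 1, let x = (x_0, …, x_n) ∈ ℝ^{n+1}, and let 1 ≤ k ≤ n. Suppose i, j are integers with 0 ≤ i < k ≤ j ≤ n such that the segment joining (i, x_i) and (j, x_j) lies on the lower boundary of the Newton polygon of x, in the sense that for every m with 0 ≤ m ≤ n one has (j − i)·x_m ≥ (j − m)·x_i + (m − i)·x_j. Then g_k(x) = (x_i − x_j)/(j − i). -/
/-- if `0 ≤ i < k ≤ j ≤ n` and the segment joining `(i, x_i)` and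
`(j, x_j)` lies on the lower boundary of the Newton polygon of `x`, i.e. every
point `(m, x_m)` lies on or above the line through `(i, x_i)` and `(j, x_j)`,
then `g_k(x) = (x_i − x_j)/(j − i)`. -/
theorem tropG_eq_edge_slope (n : ℕ) (hn : 1 ≤ n) (x : ℕ → ℝ) (k : ℕ)
    (h1 : 1 ≤ k) (h2 : k ≤ n) (i j : ℕ) (hik : i < k) (hkj : k ≤ j) (hjn : j ≤ n)
    (hedge : ∀ m : ℕ, m ≤ n →
      ((j : ℝ) - i) * x m ≥ ((j : ℝ) - m) * x i + ((m : ℝ) - i) * x j) :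
    tropG n k x h1 h2 = (x i - x j) / ((j : ℝ) - i) := by
  have hij : (0 : ℝ) < (j : ℝ) - i := sub_pos.mpr (by exact_mod_cast hik.trans_le hkj)
  unfold tropG
  apply le_antisymm
  · refine (Finset.inf'_le _ (Finset.mem_range.mpr hik)).trans (Finset.sup'_le _ _ fun q hq => ?_)
    obtain ⟨hkq, hqn⟩ := Finset.mem_Icc.mp hq
    have hiq : (0 : ℝ) < (q : ℝ) - i := sub_pos.mpr (by exact_mod_cast hik.trans_le hkq)
    rw [div_le_div_iff₀ hiq hij]
    linarith [hedge q hqn]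
  · refine Finset.le_inf' _ _ fun p hp => ?_
    have hpk := Finset.mem_range.mp hp
    have hpj : (0 : ℝ) < (j : ℝ) - p := sub_pos.mpr (by exact_mod_cast hpk.trans_le hkj)
    refine le_trans ?_ (Finset.le_sup' (fun q : ℕ => (x p - x q) / ((q : ℝ) - (p : ℝ)))
      (Finset.mem_Icc.mpr ⟨hkj, hjn⟩))
    rw [div_le_div_iff₀ hij hpj]
    linarith [hedge p (hpk.le.trans h2)]
end

section
/- Let n ≥ 1 and let x = (x_0, …, x_n) ∈ ℝ^{n+1} be strictly convex, i.e., x_{m+1} − x_m > x_m − x_{m-1} for all 1 ≤ m ≤ n−1 (so that the Newton polygon of x has all n+1 points (m, x_m) as vertices). Then for every k with 1 ≤ k ≤ n, g_k(x) = x_{k-1} − x_k. -/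
/-- The successive differences of a convex finite sequence are monotone. -/
theorem slope_le_slope_of_convex {n : ℕ} {x : ℕ → ℝ}
    (hconv : ∀ m : ℕ, 1 ≤ m → m + 1 ≤ n → x m - x (m - 1) ≤ x (m + 1) - x m)
    {a b : ℕ} (hab : a ≤ b) (hb : b + 1 ≤ n) : x (a + 1) - x a ≤ x (b + 1) - x b := by
  induction b, hab using Nat.le_induction with
  | base => exact le_rfl
  | succ b _ ih =>
    have h := hconv (b + 1) (by omega) hb
    rw [Nat.add_sub_cancel] at h
    exact (ih (by omega)).trans h

/-- A convex finite sequence lies above the line through any two consecutive points. -/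
theorem supporting_line_le_of_convex {n : ℕ} {x : ℕ → ℝ}
    (hconv : ∀ m : ℕ, 1 ≤ m → m + 1 ≤ n → x m - x (m - 1) ≤ x (m + 1) - x m)
    {j i : ℕ} (hj : j + 1 ≤ n) (hi : i ≤ n) :
    x j + ((i : ℝ) - j) * (x (j + 1) - x j) ≤ x i := by
  rcases le_total j i with hji | hij
  · induction i, hji using Nat.le_induction with
    | base => simp
    | succ i hji ih =>
      have h := slope_le_slope_of_convex hconv hji hi
      have := ih (by omega)
      push_cast
      linarith
  · induction hij using Nat.decreasingInduction with
    | self => simp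
    | of_succ i hij ih =>
      have h := slope_le_slope_of_convex hconv hij.le hj
      have := ih (by omega)
      push_cast at this
      linarith

/-- if `x` is strictly convex, i.e. `x_{m+1} − x_m > x_m − x_{m-1}`
for all `1 ≤ m ≤ n−1`, then `g_k(x) = x_{k-1} − x_k` for every `1 ≤ k ≤ n`. -/
theorem tropG_of_strictConvex (n : ℕ) (hn : 1 ≤ n) (x : ℕ → ℝ)
    (hconv : ∀ m : ℕ, 1 ≤ m → m + 1 ≤ n → x (m + 1) - x m > x m - x (m - 1))
    (k : ℕ) (h1 : 1 ≤ k) (h2 : k ≤ n) :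
    tropG n k x h1 h2 = x (k - 1) - x k := by
  obtain ⟨j, rfl⟩ : ∃ j, k = j + 1 := ⟨k - 1, by omega⟩
  have line {i : ℕ} (hi : i ≤ n) : x j + ((i : ℝ) - j) * (x (j + 1) - x j) ≤ x i :=
    supporting_line_le_of_convex (fun m hm hmn => (hconv m hm hmn).le) h2 hi
  rw [Nat.add_sub_cancel]
  unfold tropG
  apply le_antisymm
  · refine Finset.inf'_le_of_le _ (b := j) (by simp) (Finset.sup'_le _ _ fun q hq => ?_)
    obtain ⟨hjq, hqn⟩ := Finset.mem_Icc.mp hq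
    have hpos : (0 : ℝ) < (q : ℝ) - j := sub_pos.mpr (by exact_mod_cast hjq)
    rw [div_le_iff₀ hpos]
    linarith [line hqn]
  · refine Finset.le_inf' _ _ fun p hp => ?_
    have hpj : p < j + 1 := Finset.mem_range.mp hp
    refine Finset.le_sup'_of_le _ (b := j + 1) (by simpa using h2) ?_
    have hpos : (0 : ℝ) < ((j + 1 : ℕ) : ℝ) - p := sub_pos.mpr (by exact_mod_cast hpj)
    rw [le_div_iff₀ hpos]
    push_cast
    linarith [line (i := p) (by omega)]
end

section
/- Let n ≥ 1, let x = (x_0, …, x_n) ∈ ℝ^{n+1}, and let 1 ≤ k ≤ n. Suppose i, j are integers with 0 ≤ i < k ≤ j ≤ n such that for every m with 0 ≤ m ≤ n one has (j − i)·x_m ≥ (j − m)·x_i + (m − i)·x_j. Then t_i(x) = max_{k ≤ q ≤ n} (x_i − x_q)/(q − i) = (x_i − x_j)/(j − i); that is, the maximum defining t_i is attained at q = j and equals the slope of the edge from (i, x_i) to (j, x_j). -/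
/-- `t_p(x) = max_{k ≤ q ≤ n} (x_p − x_q)/(q − p)`. -/
noncomputable def tropT (n k p : ℕ) (x : ℕ → ℝ) (h2 : k ≤ n) : ℝ :=
  (Finset.Icc k n).sup' (Finset.nonempty_Icc.mpr h2)
    (fun q => (x p - x q) / ((q : ℝ) - (p : ℝ)))

/-- if `0 ≤ i < k ≤ j ≤ n` and every point `(m, x_m)` lies on or
above the line through `(i, x_i)` and `(j, x_j)`, then
`t_i(x) = max_{k ≤ q ≤ n} (x_i − x_q)/(q − i) = (x_i − x_j)/(j − i)`:
the maximum defining `t_i` is attained at `q = j` and equals the slope of the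
edge from `(i, x_i)` to `(j, x_j)`. -/
theorem tropT_eq_edge_slope (n : ℕ) (hn : 1 ≤ n) (x : ℕ → ℝ) (k : ℕ)
    (h1 : 1 ≤ k) (h2 : k ≤ n) (i j : ℕ) (hik : i < k) (hkj : k ≤ j) (hjn : j ≤ n)
    (hedge : ∀ m : ℕ, m ≤ n →
      ((j : ℝ) - i) * x m ≥ ((j : ℝ) - m) * x i + ((m : ℝ) - i) * x j) :
    tropT n k i x h2 = (x i - x j) / ((j : ℝ) - i) := by
  have pos : ∀ q : ℕ, k ≤ q → (0 : ℝ) < (q : ℝ) - i := fun q hq =>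
    sub_pos.mpr (Nat.cast_lt.mpr (hik.trans_le hq))
  apply le_antisymm
  · refine Finset.sup'_le _ _ fun q hq => ?_
    obtain ⟨hkq, hqn⟩ := Finset.mem_Icc.mp hq
    rw [div_le_div_iff₀ (pos q hkq) (pos j hkj)]
    linarith [hedge q hqn]
  · exact Finset.le_sup' (fun q : ℕ => (x i - x q) / ((q : ℝ) - (i : ℝ)))
      (Finset.mem_Icc.mpr ⟨hkj, hjn⟩)
end

section
/- Let n ≥ 2 and let x = (x_0, …, x_n) ∈ ℝ^{n+1} be strictly convex, i.e., x_{m+1} − x_m > x_m − x_{m-1} for all 1 ≤ m ≤ n−1. Then the n values g_1(x), g_2(x), …, g_n(x) are pairwise distinct; in fact g_1(x) > g_2(x) > … > g_n(x). Consequently, at such x the tropical polynomial f(Y) = min_{0 ≤ m ≤ n} (x_m + mY) has exactly n distinct tropical zeroes, and the n functions g_1, …, g_n on ℝ^{n+1} are pairwise distinct. -/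
/-- Consecutive differences of a strictly convex finite sequence are strictly increasing. -/
theorem sub_lt_sub_of_strictConvex {n : ℕ} {x : ℕ → ℝ}
    (hconv : ∀ m : ℕ, 1 ≤ m → m + 1 ≤ n → x (m + 1) - x m > x m - x (m - 1))
    {i j : ℕ} (hij : i < j) (hj : j < n) : x (i + 1) - x i < x (j + 1) - x j := by
  induction j, hij using Nat.le_induction with
  | base => simpa using hconv (i + 1) (by omega) hj
  | succ k hk ih =>
    have h := hconv (k + 1) (by omega) hj
    rw [Nat.add_sub_cancel] at h
    exact (ih (by omega)).trans h

theorem sub_le_sub_of_strictConvex {n : ℕ} {x : ℕ → ℝ}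
    (hconv : ∀ m : ℕ, 1 ≤ m → m + 1 ≤ n → x (m + 1) - x m > x m - x (m - 1))
    {i j : ℕ} (hij : i ≤ j) (hj : j < n) : x (i + 1) - x i ≤ x (j + 1) - x j := by
  rcases hij.eq_or_lt with rfl | h
  · rfl
  · exact (sub_lt_sub_of_strictConvex hconv h hj).le

/-- A strictly convex finite sequence lies above the line through two consecutive points. -/
theorem supporting_line_le_of_strictConvex {n : ℕ} {x : ℕ → ℝ}
    (hconv : ∀ m : ℕ, 1 ≤ m → m + 1 ≤ n → x (m + 1) - x m > x m - x (m - 1))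
    {j m : ℕ} (hj : j < n) (hm : m ≤ n) :
    x j + ((m : ℝ) - j) * (x (j + 1) - x j) ≤ x m := by
  rcases le_total j m with h | h
  · induction m, h using Nat.le_induction with
    | base => simp
    | succ k hk ih =>
      have h1 := ih (by omega)
      have h2 := sub_le_sub_of_strictConvex hconv hk (by omega)
      push_cast
      linarith
  · induction h using Nat.decreasingInduction with
    | self => simp
    | of_succ k hk ih =>
      have h1 := ih (by omega)
      have h2 := sub_le_sub_of_strictConvex hconv hk.le hj
      push_cast at h1
      linarith

/-- On strictly convex sequences, `tropG` is the negative of a consecutive difference. -/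
theorem tropG_eq_of_strictConvex {n : ℕ} {x : ℕ → ℝ}
    (hconv : ∀ m : ℕ, 1 ≤ m → m + 1 ≤ n → x (m + 1) - x m > x m - x (m - 1))
    {j : ℕ} (h1 : 1 ≤ j + 1) (h2 : j + 1 ≤ n) :
    tropG n (j + 1) x h1 h2 = -(x (j + 1) - x j) := by
  unfold tropG
  apply le_antisymm
  · refine (Finset.inf'_le _ (Finset.mem_range.mpr (Nat.lt_succ_self j))).trans ?_
    refine Finset.sup'_le _ _ fun q hq => ?_
    rw [Finset.mem_Icc] at hq
    have hpos : (j : ℝ) < q := by exact_mod_cast hq.1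
    rw [div_le_iff₀ (sub_pos.mpr hpos)]
    linarith [supporting_line_le_of_strictConvex hconv h2 hq.2]
  · refine Finset.le_inf' _ _ fun p hp => ?_
    rw [Finset.mem_range] at hp
    refine le_trans ?_ (Finset.le_sup' _ (Finset.mem_Icc.mpr ⟨le_rfl, h2⟩))
    have hpos : (p : ℝ) < (j + 1 : ℕ) := by exact_mod_cast hp
    rw [le_div_iff₀ (sub_pos.mpr hpos)]
    have h := supporting_line_le_of_strictConvex hconv h2 (by omega : p ≤ n)
    push_cast
    linarith

/-- The tropical zeroes at a strictly convex point are the negatives of the consecutive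
differences. -/
theorem setOf_isTropicalZero_of_strictConvex {n : ℕ} {x : ℕ → ℝ}
    (hconv : ∀ m : ℕ, 1 ≤ m → m + 1 ≤ n → x (m + 1) - x m > x m - x (m - 1)) :
    {y : ℝ | IsTropicalZero n x y} = (fun j => -(x (j + 1) - x j)) '' Set.Iio n := by
  ext y
  constructor
  · rintro ⟨a, b, ha, hb, hab, heq, hmin⟩
    wlog hlt : a < b generalizing a b
    · exact this b a hb ha hab.symm heq.symm (fun m hm => heq ▸ hmin m hm) (by omega)
    have hb' : b = a + 1 := by
      by_contra hne
      have h1 := hmin (a + 1) (by omega)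
      have h2 := supporting_line_le_of_strictConvex hconv (by omega : a + 1 < n) hb
      have h3 := sub_lt_sub_of_strictConvex hconv (Nat.lt_succ_self a) (by omega : a + 1 < n)
      have h4 : (0 : ℝ) < b - (a + 1 : ℕ) := by
        rw [sub_pos]
        exact_mod_cast (by omega : a + 1 < b)
      have h5 : 0 < (b - ((a + 1 : ℕ) : ℝ)) * (x (a + 1 + 1) - x (a + 1) + y) := by
        refine mul_pos h4 ?_
        push_cast at h1
        simp only [Nat.succ_eq_add_one] at h3
        linarith
      push_cast at h1 h2 h5
      linarith
    subst hb'
    refine ⟨a, hlt.trans_le hb, ?_⟩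
    push_cast at heq
    simp only
    linarith
  · rintro ⟨j, hj, rfl⟩
    have hj' : j < n := hj
    refine ⟨j, j + 1, hj'.le, hj', by omega, by push_cast; ring, fun m hm => ?_⟩
    linarith [supporting_line_le_of_strictConvex hconv hj' hm]

/-- if `n ≥ 2` and `x` is strictly convex then
`g_1(x) > g_2(x) > … > g_n(x)` (in particular the values are pairwise
distinct); consequently at such `x` the tropical polynomial
`f(Y) = min_{0 ≤ m ≤ n} (x_m + m·Y)` has exactly `n` distinct tropical zeroes,
and the `n` functions `g_1, …, g_n` on `ℝ^{n+1}` are pairwise distinct. -/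
theorem tropG_strictAnti_of_strictConvex (n : ℕ) (hn : 2 ≤ n) (x : ℕ → ℝ)
    (hconv : ∀ m : ℕ, 1 ≤ m → m + 1 ≤ n → x (m + 1) - x m > x m - x (m - 1)) :
    (∀ k l : ℕ, ∀ hk1 : 1 ≤ k, ∀ hk2 : k ≤ n, ∀ hl1 : 1 ≤ l, ∀ hl2 : l ≤ n,
      k < l → tropG n k x hk1 hk2 > tropG n l x hl1 hl2) ∧
    Set.ncard {y : ℝ | IsTropicalZero n x y} = n ∧
    (∀ k l : ℕ, ∀ hk1 : 1 ≤ k, ∀ hk2 : k ≤ n, ∀ hl1 : 1 ≤ l, ∀ hl2 : l ≤ n,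
      k ≠ l →
      (fun x' : ℕ → ℝ => tropG n k x' hk1 hk2) ≠
        (fun x' : ℕ → ℝ => tropG n l x' hl1 hl2)) := by
  have hanti : ∀ k l : ℕ, ∀ hk1 : 1 ≤ k, ∀ hk2 : k ≤ n, ∀ hl1 : 1 ≤ l, ∀ hl2 : l ≤ n,
      k < l → tropG n k x hk1 hk2 > tropG n l x hl1 hl2 := by
    intro k l hk1 hk2 hl1 hl2 hkl
    obtain ⟨i, rfl⟩ := Nat.exists_eq_add_of_le' hk1
    obtain ⟨j, rfl⟩ := Nat.exists_eq_add_of_le' hl1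
    rw [tropG_eq_of_strictConvex hconv, tropG_eq_of_strictConvex hconv]
    exact neg_lt_neg (sub_lt_sub_of_strictConvex hconv (by omega) hl2)
  refine ⟨hanti, ?_, fun k l hk1 hk2 hl1 hl2 hkl h => ?_⟩
  · have hinj : Set.InjOn (fun j => -(x (j + 1) - x j)) (Set.Iio n) := by
      refine StrictAntiOn.injOn fun i _ j hj hij => ?_
      exact neg_lt_neg (sub_lt_sub_of_strictConvex hconv hij hj)
    rw [setOf_isTropicalZero_of_strictConvex hconv, hinj.ncard_image, ← Finset.coe_Iio,
      Set.ncard_coe_finset, Nat.card_Iio]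
  · have hx := congrFun h x
    rcases hkl.lt_or_gt with hlt | hlt
    · exact (hanti k l hk1 hk2 hl1 hl2 hlt).ne' hx
    · exact (hanti l k hl1 hl2 hk1 hk2 hlt).ne hx
end
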